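/- arXiv:2110.04842 — 2 statements merged into one kernel-verified Lean document; each statement's English description precedes it below -/
import Mathlib

section
/- Let Σ = {ℝ_{≥0}, {0}, ℝ_{≤0}} ⊆ P(ℝ), and for a tuple u ∈ ℝ^k define Σ_u := {(τ_1, …, τ_k) ∈ Σ^k : ∃ x ∈ ℝ such that u_i + x ∈ τ_i for all i}. Let m ≥ 1, let v = (v_1, …, v_{m+1}) ∈ ℝ^{m+1}, and let u = (u_1, …, u_m) ∈ ℝ^m be such that Σ_{(v_1,…,v_m)} = Σ_u. Then there exists x ∈ ℝ such that Σ_v = Σ_{(u_1, …, u_m, x)}. -/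
/-- The set of cones of the normal fan of the segment `Δ_1 = [0,1] ⊆ ℝ`:
`ℝ_{≥0}`, `{0}`, and `ℝ_{≤0}`. -/
def segmentFan : Set (Set ℝ) := {Set.Ici 0, {0}, Set.Iic 0}

/-- For `u = (u_1,…,u_k) ∈ ℝ^k`, the set `Σ_u` of tuples `(τ_1,…,τ_k)` of cones of the
normal fan of `Δ_1` such that `u_i + x ∈ τ_i` for all `i`, for some `x ∈ ℝ`. -/
def sigmaTuples (k : ℕ) (u : Fin k → ℝ) : Set (Fin k → Set ℝ) :=
  {τ | (∀ i, τ i ∈ segmentFan) ∧ ∃ x : ℝ, ∀ i, u i + x ∈ τ i}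

/-- Two finite families in linear orders, the second order dense without endpoints, that are
ordered alike remain so after adjoining any element to the first family and a suitable element
to the second. -/
theorem exists_cmp_eq_of_cmp_eq {ι α β : Type*} [Finite ι] [LinearOrder α] [LinearOrder β]
    [DenselyOrdered β] [NoMinOrder β] [NoMaxOrder β] [Nonempty β] {v : ι → α} {w : ι → β}
    (h : ∀ i j, cmp (v i) (v j) = cmp (w i) (w j)) (a : α) :
    ∃ b : β, ∀ i, cmp (v i) a = cmp (w i) b := by
  classical
  have := Fintype.ofFinite ι
  let f : Order.PartialIso α β := ⟨Finset.univ.image fun i => (v i, w i), by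
    simp only [Finset.mem_image, Finset.mem_univ, true_and]
    rintro _ ⟨i, rfl⟩ _ ⟨j, rfl⟩
    exact h i j⟩
  obtain ⟨b, hb⟩ := Order.PartialIso.exists_across f a
  exact ⟨b, fun i => hb (v i, w i) (Finset.mem_image_of_mem _ (Finset.mem_univ i))⟩

theorem add_mem_iff_of_mem_segmentFan {s : Set ℝ} (hs : s ∈ segmentFan) {a b x y : ℝ}
    (h : cmp a (-x) = cmp b (-y)) : a + x ∈ s ↔ b + y ∈ s := by
  have h₁ : 0 ≤ a + x ↔ 0 ≤ b + y := by
    simpa only [neg_le_iff_add_nonneg] using le_iff_le_of_cmp_eq_cmp (cmp_eq_cmp_symm.mp h)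
  have h₂ : a + x ≤ 0 ↔ b + y ≤ 0 := by
    simpa only [le_neg_iff_add_nonpos_right] using le_iff_le_of_cmp_eq_cmp h
  rcases hs with rfl | rfl | rfl
  · exact h₁
  · simp only [Set.mem_singleton_iff, le_antisymm_iff, h₁, h₂]
  · exact h₂

theorem sigmaTuples_subset_of_cmp_eq {k : ℕ} {v w : Fin k → ℝ}
    (h : ∀ i j, cmp (v i) (v j) = cmp (w i) (w j)) : sigmaTuples k v ⊆ sigmaTuples k w := by
  rintro τ ⟨hτ, x, hx⟩
  obtain ⟨b, hb⟩ := exists_cmp_eq_of_cmp_eq h (-x)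
  refine ⟨hτ, -b, fun i => (add_mem_iff_of_mem_segmentFan (hτ i) ?_).mp (hx i)⟩
  rw [neg_neg, hb]

theorem sigmaTuples_eq_of_cmp_eq {k : ℕ} {v w : Fin k → ℝ}
    (h : ∀ i j, cmp (v i) (v j) = cmp (w i) (w j)) : sigmaTuples k v = sigmaTuples k w :=
  (sigmaTuples_subset_of_cmp_eq h).antisymm
    (sigmaTuples_subset_of_cmp_eq fun i j => (h i j).symm)

theorem le_iff_exists_mem_sigmaTuples {k : ℕ} (v : Fin k → ℝ) {i j : Fin k} (hij : i ≠ j) :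
    v i ≤ v j ↔ ∃ τ ∈ sigmaTuples k v, τ i = Set.Iic 0 ∧ τ j = Set.Ici 0 := by
  constructor
  · intro h
    refine ⟨fun l => if l = i then Set.Iic 0 else if v i ≤ v l then Set.Ici 0 else Set.Iic 0,
      ⟨fun l => ?_, -v i, fun l => ?_⟩, by simp, by simp [hij.symm, h]⟩
    · dsimp only
      split_ifs <;> simp [segmentFan]
    · dsimp only
      split_ifs with h₁ h₂
      · simp [h₁]
      · simpa using h₂
      · simpa using (not_le.mp h₂).le
  · rintro ⟨τ, ⟨-, x, hx⟩, hi, hj⟩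
    have h₁ := hx i
    have h₂ := hx j
    rw [hi, Set.mem_Iic] at h₁
    rw [hj, Set.mem_Ici] at h₂
    linarith

theorem cmp_eq_of_sigmaTuples_eq {k : ℕ} {v w : Fin k → ℝ}
    (h : sigmaTuples k v = sigmaTuples k w) (i j : Fin k) :
    cmp (v i) (v j) = cmp (w i) (w j) := by
  rcases eq_or_ne i j with rfl | hij
  · simp
  have h₁ : v i ≤ v j ↔ w i ≤ w j := by
    rw [le_iff_exists_mem_sigmaTuples v hij, le_iff_exists_mem_sigmaTuples w hij, h]
  have h₂ : v j ≤ v i ↔ w j ≤ w i := by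
    rw [le_iff_exists_mem_sigmaTuples v hij.symm, le_iff_exists_mem_sigmaTuples w hij.symm, h]
  simp only [cmp, cmpUsing, ← not_le, h₁, h₂]

/-- Key lemma for the Losev–Manin family: if `v ∈ ℝ^{m+1}` and `u ∈ ℝ^m` satisfy
`Σ_{(v_1,…,v_m)} = Σ_u`, then there exists `x ∈ ℝ` with `Σ_v = Σ_{(u_1,…,u_m,x)}`. -/
theorem stmt_8 (m : ℕ) (hm : 1 ≤ m)
    (v : Fin (m + 1) → ℝ) (u : Fin m → ℝ)
    (h : sigmaTuples m (v ∘ Fin.castSucc) = sigmaTuples m u) :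
    ∃ x : ℝ, sigmaTuples (m + 1) v = sigmaTuples (m + 1) (Fin.snoc u x) := by
  have hc := cmp_eq_of_sigmaTuples_eq h
  obtain ⟨x, hx⟩ := exists_cmp_eq_of_cmp_eq hc (v (Fin.last m))
  refine ⟨x, sigmaTuples_eq_of_cmp_eq fun i j => ?_⟩
  induction i using Fin.lastCases with
  | last =>
    induction j using Fin.lastCases with
    | last => simp
    | cast j => simpa using cmp_eq_cmp_symm.mp (hx j)
  | cast i =>
    induction j using Fin.lastCases with
    | last => simpa using hx i
    | cast j => simpa using hc i j
end

section
/- Let Σ = {ℝ_{≥0}, {0}, ℝ_{≤0}} ⊆ P(ℝ), and for a tuple u ∈ ℝ^k define Σ_u := {(τ_1, …, τ_k) ∈ Σ^k : ∃ x ∈ ℝ such that u_i + x ∈ τ_i for all i}. Let m ≥ 1 and define F : ℝ^{m+1} → ℝ^m by F(v) = (v_1 − v_{m+1}, …, v_m − v_{m+1}). Then for all v, w ∈ ℝ^{m+1}, the following are equivalent: (a) Σ_v = Σ_w; (b) Σ_{F(v)} = Σ_{F(w)} and for every i ∈ {1, …, m} and every σ ∈ Σ, F(v)_i ∈ σ ⟺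 F(w)_i ∈ σ. -/
/-- The map `F(v) = (v_1 − v_{m+1}, …, v_m − v_{m+1})`. -/
def lmMap (m : ℕ) (v : Fin (m + 1) → ℝ) : Fin m → ℝ :=
  fun i => v i.castSucc - v (Fin.last m)

/-- A change of vector that preserves the weak ordering of the coordinates can only enlarge the
set of cone tuples met by some translate. -/
lemma sigmaTuples_subset_of_le_imp_le {k : ℕ} {u u' : Fin k → ℝ}
    (h : ∀ i j, u i ≤ u j → u' i ≤ u' j) : sigmaTuples k u ⊆ sigmaTuples k u' := by
  rintro τ ⟨hτ, x, hx⟩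
  have hfac : u'.FactorsThrough u := fun i j hij => le_antisymm (h i j hij.le) (h j i hij.ge)
  have hf : ∀ i, Function.extend u u' 0 (u i) = u' i := fun i => hfac.extend_apply 0 i
  have hmono : MonotoneOn (Function.extend u u' 0) (Set.range u) := by
    rintro _ ⟨i, rfl⟩ _ ⟨j, rfl⟩ hij
    rw [hf, hf]
    exact h i j hij
  have hfin : (Function.extend u u' 0 '' Set.range u).Finite := (Set.finite_range u).image _
  obtain ⟨g, hg, hgf⟩ := hmono.exists_monotone_extension hfin.bddBelow hfin.bddAbove
  have hgu : ∀ i, g (u i) = u' i := fun i => (hgf ⟨i, rfl⟩).symm.trans (hf i)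
  refine ⟨hτ, -g (-x), fun i => ?_⟩
  have hxi := hx i
  rw [← hgu i]
  rcases hτ i with hi | hi | hi <;> rw [hi] at hxi ⊢
  · have : 0 ≤ u i + x := hxi
    have := hg (show -x ≤ u i by linarith)
    exact Set.mem_Ici.2 (by linarith)
  · have : u i + x = 0 := hxi
    rw [show u i = -x by linarith]
    exact add_neg_cancel _
  · have : u i + x ≤ 0 := hxi
    have := hg (show u i ≤ -x by linarith)
    exact Set.mem_Iic.2 (by linarith)

lemma le_of_sigmaTuples_subset {k : ℕ} {u u' : Fin k → ℝ}
    (h : sigmaTuples k u ⊆ sigmaTuples k u') {i j : Fin k} (hij : u i ≤ u j) : u' i ≤ u' j := by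
  classical
  let τ : Fin k → Set ℝ := fun l =>
    if l = j then {0} else if u l ≤ u j then Set.Iic 0 else Set.Ici 0
  have hτ : τ ∈ sigmaTuples k u := by
    refine ⟨fun l => ?_, -u j, fun l => ?_⟩
    · simp only [τ, segmentFan]
      split_ifs <;> simp
    · simp only [τ]
      split_ifs with h₁ h₂
      · simp [h₁]
      · simpa using h₂
      · simpa using (not_le.1 h₂).le
  obtain ⟨-, x, hx⟩ := h hτ
  rcases eq_or_ne i j with rfl | hne
  · exact le_rfl
  have hi := hx i
  have hj := hx j
  simp only [τ, if_neg hne, if_pos hij, if_true, Set.mem_Iic, Set.mem_singleton_iff] at hi hj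
  linarith

/-- `Σ_u` determines, and is determined by, the weak ordering of the coordinates of `u`. -/
lemma sigmaTuples_eq_iff {k : ℕ} {u u' : Fin k → ℝ} :
    sigmaTuples k u = sigmaTuples k u' ↔ ∀ i j, u i ≤ u j ↔ u' i ≤ u' j :=
  ⟨fun h _ _ => ⟨le_of_sigmaTuples_subset h.subset, le_of_sigmaTuples_subset h.superset⟩,
    fun h => (sigmaTuples_subset_of_le_imp_le fun i j => (h i j).1).antisymm
      (sigmaTuples_subset_of_le_imp_le fun i j => (h i j).2)⟩

lemma forall_segmentFan_mem_iff {a b : ℝ} :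
    (∀ σ ∈ segmentFan, (a ∈ σ ↔ b ∈ σ)) ↔ (0 ≤ a ↔ 0 ≤ b) ∧ (a ≤ 0 ↔ b ≤ 0) := by
  simp only [segmentFan, Set.mem_insert_iff, Set.mem_singleton_iff, forall_eq_or_imp, forall_eq,
    Set.mem_Ici, Set.mem_Iic]
  have ha : a = 0 ↔ a ≤ 0 ∧ 0 ≤ a := le_antisymm_iff
  have hb : b = 0 ↔ b ≤ 0 ∧ 0 ≤ b := le_antisymm_iff
  tauto

/-- For `v, w ∈ ℝ^{m+1}`: `Σ_v = Σ_w` iff `Σ_{F(v)} = Σ_{F(w)}` and, for each coordinate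
`i` and each cone `σ` of the normal fan of `Δ_1`, `F(v)_i ∈ σ ⟺ F(w)_i ∈ σ`. -/
theorem stmt_9 (m : ℕ) (hm : 1 ≤ m) (v w : Fin (m + 1) → ℝ) :
    sigmaTuples (m + 1) v = sigmaTuples (m + 1) w ↔
      (sigmaTuples m (lmMap m v) = sigmaTuples m (lmMap m w) ∧
        ∀ i : Fin m, ∀ σ ∈ segmentFan, (lmMap m v i ∈ σ ↔ lmMap m w i ∈ σ)) := by
  simp only [sigmaTuples_eq_iff, forall_segmentFan_mem_iff, lmMap, sub_le_sub_iff_right,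
    sub_nonneg, sub_nonpos]
  refine ⟨fun h => ⟨fun i j => h _ _, fun i => ⟨h _ _, h _ _⟩⟩, fun ⟨h, hl⟩ i j => ?_⟩
  induction i using Fin.lastCases with
  | last =>
    induction j using Fin.lastCases with
    | last => simp
    | cast j => exact (hl j).1
  | cast i =>
    induction j using Fin.lastCases with
    | last => exact (hl i).2
    | cast j => exact h i j
end
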